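/- Let A ⊆ B be a (φ,ψ)-bounded extension of the multi-filtered K-algebra A and let r ∈ F̃_δ(B) be nonzero. Then there exist (α₁,α₂) ∈ ℕ^m × ℕ^s with α := wt(α₁,α₂) ⪯ δ, an element r' ∈ F_{α₁}(A), and an element u ∈ Σ_{(γ₂, wt(γ)) ≺' (α₂, α)} F_{γ₁}(A)x^{γ₂}, such that r = r' x^{α₂} + u. -/

import Mathlib

open scoped BigOperators

/-- Multi-indices: elements of `ℕ^n`. -/
abbrev MIdx (n : ℕ) := Fin n → ℕ

/-- An admissible order on `ℕ^n`: a total order compatible with addition and having `0` as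
least element. -/
structure AdmOrder (n : ℕ) where
  le : MIdx n → MIdx n → Prop
  le_refl : ∀ a, le a a
  le_trans : ∀ {a b c}, le a b → le b c → le a c
  le_antisymm : ∀ {a b}, le a b → le b a → a = b
  le_total : ∀ a b, le a b ∨ le b a
  add_right : ∀ {a b : MIdx n} (c : MIdx n), le a b → le (a + c) (b + c)
  zero_le : ∀ a, le 0 a

/-- The strict order associated to an admissible order. -/
def AdmOrder.lt {n : ℕ} (o : AdmOrder n) (a b : MIdx n) : Prop :=
  o.le a b ∧ a ≠ b

/-- The ordered standard monomial `x^β = x₁^{β₁} ⋯ x_s^{β_s}`. -/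
def smon {B : Type*} [Monoid B] {s : ℕ} (x : Fin s → B) (β : MIdx s) : B :=
  (List.ofFn fun i => x i ^ β i).prod

/-- The `K`-submodule `Σ_{γ with P γ} F_{γ₁}(A)·x^{γ₂}` of `B`. -/
def monSum (K : Type*) [CommRing K] (B : Type*) [Ring B] [Algebra K B]
    {m s : ℕ} (F : MIdx m → Submodule K B) (x : Fin s → B)
    (P : MIdx m × MIdx s → Prop) : Submodule K B :=
  ⨆ γ ∈ {γ : MIdx m × MIdx s | P γ},
    (F γ.1).map (LinearMap.mulRight K (smon x γ.2))

/-- A `(φ,ψ)`-bounded extension `A ⊆ B` of a multi-filtered `K`-algebra `A`, where `A` is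
realized as a subalgebra of `B` carrying an `(ℕ^m,⪯₁)`-filtration `F`, and `B` is generated
over `A` by elements `x 1, …, x s`, subject to the axioms (EA1)–(EA4). -/
structure BoundedExt (K : Type*) [CommRing K] (B : Type*) [Ring B] [Algebra K B]
    (m s n : ℕ) where
  /-- admissible order `⪯₁` on `ℕ^m` -/
  o1 : AdmOrder m
  /-- admissible order `⪯₂` on `ℕ^s` -/
  o2 : AdmOrder s
  /-- admissible order `⪯` on `ℕ^n` -/
  o : AdmOrder n
  /-- the monoid morphism `φ : ℕ^m → ℕ^n` -/
  φ : MIdx m →+ MIdx n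
  /-- the monoid morphism `ψ : ℕ^s → ℕ^n` -/
  ψ : MIdx s →+ MIdx n
  φ_mono : ∀ {a b : MIdx m}, o1.le a b → o.le (φ a) (φ b)
  ψ_mono : ∀ {a b : MIdx s}, o2.le a b → o.le (ψ a) (ψ b)
  /-- the subalgebra `A` of `B` -/
  A : Subalgebra K B
  /-- (EA1): the `(ℕ^m,⪯₁)`-filtration on `A` -/
  F : MIdx m → Submodule K B
  F_le_A : ∀ a : MIdx m, F a ≤ Subalgebra.toSubmodule A
  F_mono : ∀ {a b : MIdx m}, o1.le a b → F a ≤ F b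
  F_mul : ∀ {a b : MIdx m} {u v : B}, u ∈ F a → v ∈ F b → u * v ∈ F (a + b)
  F_exhaustive : ∀ u ∈ A, ∃ a : MIdx m, u ∈ F a
  F_one : (1 : B) ∈ F 0
  /-- the generators `x_1, …, x_s` -/
  x : Fin s → B
  /-- (EA2): `B` is generated as a `K`-algebra by `A` and `x_1, …, x_s` -/
  gen : Algebra.adjoin K ((A : Set B) ∪ Set.range x) = ⊤
  /-- (EA3) -/
  EA3 : ∀ (i : Fin s) (α : MIdx m), ∀ a ∈ F α,
    x i * a ∈ (F α).map (LinearMap.mulRight K (x i)) ⊔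
      monSum K B F x (fun γ => o.lt (φ γ.1 + ψ γ.2) (φ α + ψ (Pi.single i 1)))
  /-- (EA4) -/
  EA4 : ∀ i j : Fin s, i < j → ∃ q ∈ F 0,
    x j * x i - q * (x i * x j) ∈
      monSum K B F x (fun γ => o.lt (φ γ.1 + ψ γ.2) (ψ (Pi.single i 1 + Pi.single j 1)))

namespace BoundedExt

variable {K : Type*} [CommRing K] {B : Type*} [Ring B] [Algebra K B] {m s n : ℕ}

/-- The weight `wt(γ) = φ(γ₁) + ψ(γ₂)` of a pair of multi-indices. -/
def wt (E : BoundedExt K B m s n) (γ : MIdx m × MIdx s) : MIdx n :=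
  E.φ γ.1 + E.ψ γ.2

/-- The filtration `F̃_α(B) = Σ_{wt(γ) ⪯ α} F_{γ₁}(A)x^{γ₂}` on `B`. -/
def tF (E : BoundedExt K B m s n) (α : MIdx n) : Submodule K B :=
  monSum K B E.F E.x (fun γ => E.o.le (E.wt γ) α)

/-- `F̃_{≺α}(B) = ⋃_{β ≺ α} F̃_β(B)`. -/
def tFlt (E : BoundedExt K B m s n) (α : MIdx n) : Submodule K B :=
  ⨆ β ∈ {β : MIdx n | E.o.lt β α}, E.tF β

/-- `F_{≺α}(A) = ⋃_{β ≺₁ α} F_β(A)`. -/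
def Flt (E : BoundedExt K B m s n) (α : MIdx m) : Submodule K B :=
  ⨆ β ∈ {β : MIdx m | E.o1.lt β α}, E.F β

/-- The strict order `≺'` on `ℕ^s × ℕ^n`: `(λ,ν) ≺' (λ',ν')` iff `ν ≺ ν'`, or `ν = ν'`
and `λ ≺₂ λ'`. -/
def ltP (E : BoundedExt K B m s n) (p q : MIdx s × MIdx n) : Prop :=
  E.o.lt p.2 q.2 ∨ (p.2 = q.2 ∧ E.o2.lt p.1 q.1)

end BoundedExt

namespace AdmOrder

variable {n : ℕ} (o : AdmOrder n)

theorem lt_trans {a b c : MIdx n} (hab : o.lt a b) (hbc : o.lt b c) : o.lt a c :=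
  ⟨o.le_trans hab.1 hbc.1, fun h => hab.2 (o.le_antisymm hab.1 (h ▸ hbc.1))⟩

theorem lt_trichotomy (a b : MIdx n) : o.lt a b ∨ a = b ∨ o.lt b a := by
  by_cases h : a = b
  · exact Or.inr (Or.inl h)
  · exact (o.le_total a b).imp (fun hab => ⟨hab, h⟩) fun hba => Or.inr ⟨hba, Ne.symm h⟩

end AdmOrder

section monSum

variable {K : Type*} [CommRing K] {B : Type*} [Ring B] [Algebra K B] {m s : ℕ}
  {F : MIdx m → Submodule K B} {x : Fin s → B} {P Q : MIdx m × MIdx s → Prop}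

theorem monSum_mono (h : ∀ γ, P γ → Q γ) : monSum K B F x P ≤ monSum K B F x Q :=
  biSup_mono h

theorem mul_smon_mem_monSum {α : MIdx m} {β : MIdx s} (h : P (α, β)) {a : B} (ha : a ∈ F α) :
    a * smon x β ∈ monSum K B F x P :=
  le_biSup (fun γ : MIdx m × MIdx s => (F γ.1).map (LinearMap.mulRight K (smon x γ.2)))
    (show (α, β) ∈ {γ | P γ} from h) (Submodule.mem_map_of_mem ha)

end monSum

namespace BoundedExt

section leading

variable {K : Type*} [CommRing K] {B : Type*} [Ring B] [Algebra K B] {m s n : ℕ}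
  (E : BoundedExt K B m s n)

theorem ltP_trans {p q r : MIdx s × MIdx n} (hpq : E.ltP p q) (hqr : E.ltP q r) : E.ltP p r := by
  obtain ⟨p₁, p₂⟩ := p
  obtain ⟨q₁, q₂⟩ := q
  obtain ⟨r₁, r₂⟩ := r
  rcases hpq with h | ⟨h, h'⟩ <;> rcases hqr with k | ⟨k, k'⟩ <;> dsimp only at *
  · exact Or.inl (E.o.lt_trans h k)
  · exact Or.inl (k ▸ h)
  · exact Or.inl (h ▸ k)
  · exact Or.inr ⟨h.trans k, E.o2.lt_trans h' k'⟩

theorem ltP_trichotomy (p q : MIdx s × MIdx n) : E.ltP p q ∨ p = q ∨ E.ltP q p := by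
  rcases E.o.lt_trichotomy p.2 q.2 with h | h | h
  · exact Or.inl (Or.inl h)
  · rcases E.o2.lt_trichotomy p.1 q.1 with k | k | k
    · exact Or.inl (Or.inr ⟨h, k⟩)
    · exact Or.inr (Or.inl (Prod.ext k h))
    · exact Or.inr (Or.inr (Or.inr ⟨h.symm, k⟩))
  · exact Or.inr (Or.inr (Or.inl h))

/-- The sum of the `F_{γ₁}(A)x^{γ₂}` with `(γ₂, wt γ) ≺' (α₂, wt α)`. -/
def tail (α : MIdx m × MIdx s) : Submodule K B :=
  monSum K B E.F E.x fun γ => E.ltP (γ.2, E.wt γ) (α.2, E.wt α)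

/-- `r` is the sum of an element of `F_{α₁}(A)x^{α₂}` and of an element of the tail of `α`. -/
def HasLeading (α : MIdx m × MIdx s) (r : B) : Prop :=
  ∃ r' ∈ E.F α.1, ∃ u ∈ E.tail α, r = r' * smon E.x α.2 + u

variable {E}

theorem tail_mono {α β : MIdx m × MIdx s} (hlt : E.ltP (α.2, E.wt α) (β.2, E.wt β)) :
    E.tail α ≤ E.tail β :=
  monSum_mono fun _ hγ => E.ltP_trans hγ hlt

theorem mul_smon_mem_tail {α β : MIdx m × MIdx s} (hlt : E.ltP (α.2, E.wt α) (β.2, E.wt β))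
    {a : B} (ha : a ∈ E.F α.1) : a * smon E.x α.2 ∈ E.tail β :=
  mul_smon_mem_monSum (α := α.1) (β := α.2) hlt ha

theorem HasLeading.mem_tail {α β : MIdx m × MIdx s} {r : B} (h : E.HasLeading α r)
    (hlt : E.ltP (α.2, E.wt α) (β.2, E.wt β)) : r ∈ E.tail β := by
  obtain ⟨r', hr', u, hu, rfl⟩ := h
  exact add_mem (mul_smon_mem_tail hlt hr') (tail_mono hlt hu)

theorem HasLeading.add_mem_tail {α : MIdx m × MIdx s} {r t : B} (h : E.HasLeading α r)
    (ht : t ∈ E.tail α) : E.HasLeading α (r + t) := by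
  obtain ⟨r', hr', u, hu, rfl⟩ := h
  exact ⟨r', hr', u + t, add_mem hu ht, add_assoc _ _ _⟩

theorem HasLeading.add {α : MIdx m × MIdx s} {r t : B} (hr : E.HasLeading α r)
    (ht : E.HasLeading α t) : E.HasLeading α (r + t) := by
  obtain ⟨r', hr', u, hu, rfl⟩ := hr
  obtain ⟨t', ht', v, hv, rfl⟩ := ht
  exact ⟨r' + t', add_mem hr' ht', u + v, add_mem hu hv, by rw [add_mul]; abel⟩

theorem HasLeading.of_le {α β : MIdx m × MIdx s} {r : B} (h : E.HasLeading α r)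
    (hkey : (α.2, E.wt α) = (β.2, E.wt β)) (hle : E.o1.le α.1 β.1) : E.HasLeading β r := by
  obtain ⟨r', hr', u, hu, rfl⟩ := h
  obtain ⟨h₂, hwt⟩ := Prod.ext_iff.mp hkey
  dsimp only at h₂ hwt
  refine ⟨r', E.F_mono hle hr', u, ?_, by rw [h₂]⟩
  unfold tail at hu ⊢
  rwa [← h₂, ← hwt]

theorem HasLeading.add_or {α β : MIdx m × MIdx s} {r t : B} (hr : E.HasLeading α r)
    (ht : E.HasLeading β t) : E.HasLeading α (r + t) ∨ E.HasLeading β (r + t) := by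
  rcases E.ltP_trichotomy (α.2, E.wt α) (β.2, E.wt β) with h | h | h
  · exact Or.inr (add_comm t r ▸ ht.add_mem_tail (hr.mem_tail h))
  · rcases E.o1.le_total α.1 β.1 with h₁ | h₁
    · exact Or.inr ((hr.of_le h h₁).add ht)
    · exact Or.inl (hr.add (ht.of_le h.symm h₁))
  · exact Or.inl (hr.add_mem_tail (ht.mem_tail h))

theorem exists_hasLeading_of_mem_tF {δ : MIdx n} {r : B} (hr : r ∈ E.tF δ) :
    ∃ α, E.o.le (E.wt α) δ ∧ E.HasLeading α r := by
  have hzero : ∃ α, E.o.le (E.wt α) δ ∧ E.HasLeading α (0 : B) :=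
    ⟨0, by simpa [wt] using E.o.zero_le δ, 0, zero_mem _, 0, zero_mem _, by simp⟩
  have hadd : ∀ r t : B, (∃ α, E.o.le (E.wt α) δ ∧ E.HasLeading α r) →
      (∃ α, E.o.le (E.wt α) δ ∧ E.HasLeading α t) →
      ∃ α, E.o.le (E.wt α) δ ∧ E.HasLeading α (r + t) := by
    rintro r t ⟨α, hα, hr⟩ ⟨β, hβ, ht⟩
    rcases hr.add_or ht with h | h
    exacts [⟨α, hα, h⟩, ⟨β, hβ, h⟩]
  unfold tF monSum at hr
  refine Submodule.iSup_induction _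
    (motive := fun r => ∃ α, E.o.le (E.wt α) δ ∧ E.HasLeading α r) hr (fun γ r hr => ?_) hzero hadd
  refine Submodule.iSup_induction _
    (motive := fun r => ∃ α, E.o.le (E.wt α) δ ∧ E.HasLeading α r) hr (fun hγ r hr => ?_) hzero hadd
  obtain ⟨a, ha, rfl⟩ := hr
  exact ⟨γ, hγ, a, ha, 0, zero_mem _, (add_zero _).symm⟩

end leading

end BoundedExt

/-- Every nonzero `r ∈ F̃_δ(B)` has a leading standard representation: there are
`(α₁,α₂) ∈ ℕ^m × ℕ^s` with `α := wt(α₁,α₂) ⪯ δ`, an `r' ∈ F_{α₁}(A)` and a tail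
`u ∈ Σ_{(γ₂,wt γ) ≺' (α₂,α)} F_{γ₁}(A)x^{γ₂}` such that `r = r'·x^{α₂} + u`. -/
theorem boundedExt_leading_representation {K : Type*} [CommRing K] {B : Type*} [Ring B]
    [Algebra K B] {m s n : ℕ} (E : BoundedExt K B m s n)
    (δ : MIdx n) (r : B) (hr : r ∈ E.tF δ) (hr0 : r ≠ 0) :
    ∃ (α₁ : MIdx m) (α₂ : MIdx s), E.o.le (E.wt (α₁, α₂)) δ ∧
      ∃ r' ∈ E.F α₁,
        ∃ u ∈ monSum K B E.F E.x
          (fun γ => E.ltP (γ.2, E.wt γ) (α₂, E.wt (α₁, α₂))),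
          r = r' * smon E.x α₂ + u := by
  obtain ⟨⟨α₁, α₂⟩, hα, h⟩ := BoundedExt.exists_hasLeading_of_mem_tF hr
  exact ⟨α₁, α₂, hα, h⟩
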